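/- Let G be a finite simple undirected graph on vertex set {1, …, m} with m ≥ 2, and let I'(G) be the trump-variant Crew instance obtained from the reduction instance I(G) by designating a fresh suit as the trump suit and dealing, to every player except one fixed player, an arbitrary positive number of pairwise distinct trump cards. Under the trump rules, G contains a Hamiltonian path if and only if I'(G) admits a successful play sequence. -/

import Mathlib

/-- A card is a pair (value, suit). -/
abbrev Card : Type := ℕ × ℕ

/-- A trick from state `st` led by `lead` with plays `play` is legal:
every hand is nonempty, each player plays a card from their own hand,
and every player follows the led suit if able. -/
def TrickOk {p : ℕ} (st : Fin p → Finset Card) (lead : Fin p) (play : Fin p → Card) : Prop :=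
  (∀ i, (st i).Nonempty) ∧ (∀ i, play i ∈ st i) ∧
  (∀ i, (play i).2 = (play lead).2 ∨ ∀ c ∈ st i, c.2 ≠ (play lead).2)

/-- Player `w` wins the trick: `w`'s card is of the led suit and strictly
beats every other card of the led suit. -/
def Wins {p : ℕ} (lead : Fin p) (play : Fin p → Card) (w : Fin p) : Prop :=
  (play w).2 = (play lead).2 ∧
  ∀ j, j ≠ w → (play j).2 = (play lead).2 → (play j).1 < (play w).1

/-- A played trick: its leader, the card played by each player, and its winner. -/
structure Trick (p : ℕ) where
  lead : Fin p
  play : Fin p → Card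
  winner : Fin p

/-- After a trick, each played card is removed from its owner's hand. -/
def nextState {p : ℕ} (st : Fin p → Finset Card) (play : Fin p → Card) :
    Fin p → Finset Card :=
  fun i => (st i).erase (play i)

/-- `PlaysFrom st lead L fin`: starting from hands `st` with `lead` to lead the
first trick, the list of tricks `L` is a legal play sequence ending in hands `fin`;
the winner of each trick leads the next. -/
inductive PlaysFrom {p : ℕ} :
    (Fin p → Finset Card) → Fin p → List (Trick p) → (Fin p → Finset Card) → Prop
  | nil (st : Fin p → Finset Card) (lead : Fin p) : PlaysFrom st lead [] st
  | cons {st : Fin p → Finset Card} {lead : Fin p} {play : Fin p → Card} {w : Fin p}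
      {rest : List (Trick p)} {fin : Fin p → Finset Card} :
      TrickOk st lead play → Wins lead play w →
      PlaysFrom (nextState st play) w rest fin →
      PlaysFrom st lead (⟨lead, play, w⟩ :: rest) fin

/-- Objective `o = (c, i)` is completed in trick `t` if card `c` is played in `t`
and player `i` wins `t`. -/
def Completes {p : ℕ} (t : Trick p) (o : Card × Fin p) : Prop :=
  (∃ j, t.play j = o.1) ∧ t.winner = o.2

instance {p : ℕ} (t : Trick p) (o : Card × Fin p) : Decidable (Completes t o) :=
  inferInstanceAs (Decidable ((∃ j, t.play j = o.1) ∧ t.winner = o.2))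

/-- A play sequence is successful if every objective is completed in some trick. -/
def Successful {p : ℕ} (O : Finset (Card × Fin p)) (L : List (Trick p)) : Prop :=
  ∀ o ∈ O, ∃ t ∈ L, Completes t o

/-- The structural conditions on a Crew instance: hands are pairwise disjoint
(cards are distinct), every objective card is in some hand, and no two
objectives share a card. -/
def ValidInstance {p : ℕ} (hand : Fin p → Finset Card) (O : Finset (Card × Fin p)) : Prop :=
  (∀ i j : Fin p, i ≠ j → Disjoint (hand i) (hand j)) ∧
  (∀ o ∈ O, ∃ i, o.1 ∈ hand i) ∧
  (∀ o ∈ O, ∀ q ∈ O, o.1 = q.1 → o = q)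

/-- The instance admits a successful play sequence (with an arbitrary first leader). -/
def HasSuccess {p : ℕ} (hand : Fin p → Finset Card) (O : Finset (Card × Fin p)) : Prop :=
  ∃ lead L fin, PlaysFrom hand lead L fin ∧ Successful O L

/-- Player `w` wins a trick under the trump rules with trump suit `ts`: if some
trump card was played, `w` played the highest-valued trump card, and otherwise
`w` wins in the usual way. -/
def TrumpWins {p : ℕ} (ts : ℕ) (lead : Fin p) (play : Fin p → Card) (w : Fin p) : Prop :=
  ((∃ j, (play j).2 = ts) →
    (play w).2 = ts ∧ ∀ j, j ≠ w → (play j).2 = ts → (play j).1 < (play w).1) ∧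
  ((¬ ∃ j, (play j).2 = ts) → Wins lead play w)

/-- Legal play sequences under the trump rules (following suit is as before; only
the winner rule changes). -/
inductive TrumpPlaysFrom {p : ℕ} (ts : ℕ) :
    (Fin p → Finset Card) → Fin p → List (Trick p) → (Fin p → Finset Card) → Prop
  | nil (st : Fin p → Finset Card) (lead : Fin p) : TrumpPlaysFrom ts st lead [] st
  | cons {st : Fin p → Finset Card} {lead : Fin p} {play : Fin p → Card} {w : Fin p}
      {rest : List (Trick p)} {fin : Fin p → Finset Card} :
      TrickOk st lead play → TrumpWins ts lead play w →
      TrumpPlaysFrom ts (nextState st play) w rest fin →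
      TrumpPlaysFrom ts st lead (⟨lead, play, w⟩ :: rest) fin

/-- The trump-variant instance admits a successful play sequence. -/
def TrumpHasSuccess {p : ℕ} (ts : ℕ) (hand : Fin p → Finset Card)
    (O : Finset (Card × Fin p)) : Prop :=
  ∃ lead L fin, TrumpPlaysFrom ts hand lead L fin ∧ Successful O L

/-- The hand dealt to player `j` by the reduction from a graph `G`: for each
neighbor `i` of `j`, the card `(f i j, suit i)`; the card
`(deg j + 1, suit j)`; and the junk cards of `j`. -/
def reductionHand {m : ℕ} (G : SimpleGraph (Fin m)) [DecidableRel G.Adj]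
    (f : Fin m → Fin m → ℕ) (junk : Fin m → Finset Card) : Fin m → Finset Card :=
  fun j =>
    (G.neighborFinset j).image (fun i => (f i j, (i : ℕ))) ∪
      {((G.degree j + 1 : ℕ), (j : ℕ))} ∪ junk j

/-- The objectives of the reduction: player `j` must win the card
`(deg j + 1, suit j)`. -/
def reductionObjs {m : ℕ} (G : SimpleGraph (Fin m)) [DecidableRel G.Adj] :
    Finset (Card × Fin m) :=
  Finset.univ.image (fun j => (((G.degree j + 1 : ℕ), (j : ℕ)), j))

section TrumpPlay

variable {p ts : ℕ} {st fin : Fin p → Finset Card} {lead : Fin p} {L : List (Trick p)}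

theorem TrumpPlaysFrom.length_le_card (h : TrumpPlaysFrom ts st lead L fin) (i : Fin p) :
    L.length ≤ (st i).card := by
  induction h with
  | nil => simp
  | cons hok _ _ ih =>
    rw [nextState, Finset.card_erase_of_mem (hok.2.1 i)] at ih
    have := Finset.card_pos.2 ⟨_, hok.2.1 i⟩
    simp only [List.length_cons]
    omega

theorem TrumpPlaysFrom.play_mem (h : TrumpPlaysFrom ts st lead L fin) {t : Trick p}
    (ht : t ∈ L) (i : Fin p) : t.play i ∈ st i := by
  induction h with
  | nil => simp at ht
  | cons hok _ _ ih =>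
    rcases List.mem_cons.1 ht with rfl | ht
    · exact hok.2.1 i
    · exact Finset.mem_of_mem_erase (ih ht)

theorem TrumpPlaysFrom.trumpWins (h : TrumpPlaysFrom ts st lead L fin) {t : Trick p}
    (ht : t ∈ L) : TrumpWins ts t.lead t.play t.winner := by
  induction h with
  | nil => simp at ht
  | cons _ hw _ ih =>
    rcases List.mem_cons.1 ht with rfl | ht
    · exact hw
    · exact ih ht

theorem TrumpPlaysFrom.isChain (h : TrumpPlaysFrom ts st lead L fin) :
    L.IsChain (fun t t' => t'.lead = t.winner) := by
  induction h with
  | nil => simp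
  | cons _ _ hrest ih =>
    cases hrest with
    | nil => simp
    | cons => exact List.isChain_cons_cons.2 ⟨rfl, ih⟩

end TrumpPlay

/-- A trick won with a non-trump card was led in the suit of that card. -/
theorem TrumpWins.lead_suit {p ts : ℕ} {lead : Fin p} {play : Fin p → Card} {w : Fin p}
    (h : TrumpWins ts lead play w) (hw : (play w).2 ≠ ts) : (play lead).2 = (play w).2 := by
  by_cases ht : ∃ j, (play j).2 = ts
  · exact absurd (h.1 ht).1 hw
  · exact (h.2 ht).1.symm

section Reduction

variable {m : ℕ} (G : SimpleGraph (Fin m)) [DecidableRel G.Adj] (f : Fin m → Fin m → ℕ)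

/-- The card of suit `v` that the reduction deals to player `i`, if `i` is `v` or adjacent
to `v`. -/
def suitCard (v i : Fin m) : Card :=
  if v = i then (G.degree v + 1, (v : ℕ)) else (f v i, (v : ℕ))

@[simp]
theorem suitCard_snd (v i : Fin m) : (suitCard G f v i).2 = v := by
  unfold suitCard; split_ifs <;> rfl

@[simp]
theorem suitCard_self (v : Fin m) : suitCard G f v v = (G.degree v + 1, (v : ℕ)) := by
  simp [suitCard]

variable {G f} {junk trumps : Fin m → Finset Card}

theorem suitCard_mem_reductionHand {v i : Fin m} (h : v = i ∨ G.Adj v i) :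
    suitCard G f v i ∈ reductionHand G f junk i := by
  rcases eq_or_ne v i with rfl | hne
  · simp [reductionHand]
  · have hadj := (h.resolve_left hne).symm
    simp only [suitCard, hne, if_false, reductionHand, Finset.mem_union, Finset.mem_image,
      SimpleGraph.mem_neighborFinset]
    exact .inl (.inl ⟨v, hadj, rfl⟩)

theorem card_reductionHand_le (hjcard : ∀ i, (junk i).card = m - G.degree i - 1) (i : Fin m) :
    (reductionHand G f junk i).card ≤ m := by
  have hdeg : G.degree i < m := by simpa using G.degree_lt_card_verts i
  have h₁ := Finset.card_union_le ((G.neighborFinset i).image (fun v => (f v i, (v : ℕ))) ∪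
      {((G.degree i + 1 : ℕ), (i : ℕ))}) (junk i)
  have h₂ := Finset.card_union_le ((G.neighborFinset i).image (fun v => (f v i, (v : ℕ))))
      {((G.degree i + 1 : ℕ), (i : ℕ))}
  have h₃ := Finset.card_image_le (s := G.neighborFinset i) (f := fun v => (f v i, (v : ℕ)))
  rw [SimpleGraph.card_neighborFinset_eq_degree] at h₃
  rw [Finset.card_singleton] at h₂
  rw [hjcard] at h₁
  unfold reductionHand
  omega

theorem eq_suitCard_of_mem_hand {ts : ℕ} (hjsuit : ∀ i : Fin m, ∀ c ∈ junk i, m ≤ c.2)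
    (hts_main : m ≤ ts) (htr_suit : ∀ i : Fin m, ∀ c ∈ trumps i, c.2 = ts)
    {v i : Fin m} {c : Card} (hc : c ∈ reductionHand G f junk i ∪ trumps i) (hcv : c.2 = v) :
    (v = i ∨ G.Adj v i) ∧ c = suitCard G f v i := by
  have hv := v.isLt
  simp only [reductionHand, Finset.mem_union, Finset.mem_image, Finset.mem_singleton,
    SimpleGraph.mem_neighborFinset] at hc
  rcases hc with ((⟨u, hu, rfl⟩ | rfl) | hc) | hc
  · obtain rfl : u = v := Fin.ext hcv
    exact ⟨.inr hu.symm, by simp [suitCard, hu.ne']⟩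
  · obtain rfl : i = v := Fin.ext hcv
    simp
  · have := hjsuit i c hc
    omega
  · have := htr_suit i c hc
    omega

theorem le_degree_of_adj (hf_img : ∀ i : Fin m,
    (G.neighborFinset i).image (f i) = Finset.Icc 1 (G.degree i))
    {v i : Fin m} (h : G.Adj v i) : f v i ≤ G.degree v := by
  have : f v i ∈ Finset.Icc 1 (G.degree v) :=
    hf_img v ▸ Finset.mem_image_of_mem _ (by simpa using h)
  exact (Finset.mem_Icc.1 this).2

theorem eq_of_objective_mem_hand {ts : ℕ} (hf_img : ∀ i : Fin m,
    (G.neighborFinset i).image (f i) = Finset.Icc 1 (G.degree i))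
    (hjsuit : ∀ i : Fin m, ∀ c ∈ junk i, m ≤ c.2)
    (hts_main : m ≤ ts) (htr_suit : ∀ i : Fin m, ∀ c ∈ trumps i, c.2 = ts)
    {v i : Fin m} (h : (G.degree v + 1, (v : ℕ)) ∈ reductionHand G f junk i ∪ trumps i) :
    v = i := by
  obtain ⟨hvi, hc⟩ := eq_suitCard_of_mem_hand hjsuit hts_main htr_suit h rfl
  by_contra hne
  have := le_degree_of_adj hf_img (hvi.resolve_left hne)
  simp only [suitCard, hne, if_false, Prod.mk.injEq] at hc
  omega

/-- A nodup sequence of vertices, each adjacent to its predecessor (or to the leader), can be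
played as a sequence of tricks won by these vertices with their objective cards. -/
theorem exists_trumpPlaysFrom_of_isChain {ts : ℕ} (hts_main : m ≤ ts)
    (hf_le : ∀ v i, G.Adj v i → f v i ≤ G.degree v) (l : List (Fin m)) (hnd : l.Nodup)
    (hchain : l.IsChain G.Adj) (st : Fin m → Finset Card) (lead : Fin m)
    (hlead : ∀ v ∈ l.head?, v = lead ∨ G.Adj v lead)
    (hmem : ∀ v ∈ l, ∀ i, (v = i ∨ G.Adj v i) → suitCard G f v i ∈ st i)
    (hsuit : ∀ i, ∀ c ∈ st i, ∀ v : Fin m, c.2 = v → v = i ∨ G.Adj v i)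
    (hjunk : ∀ i, l.countP (fun v => ¬ (v = i ∨ G.Adj v i)) ≤
      ((st i).filter (fun c => m ≤ c.2 ∧ c.2 ≠ ts)).card) :
    ∃ L fin, TrumpPlaysFrom ts st lead L fin ∧
      ∀ v ∈ l, ∃ t ∈ L, Completes t ((G.degree v + 1, (v : ℕ)), v) := by
  induction l generalizing st lead with
  | nil => exact ⟨[], st, .nil st lead, by simp⟩
  | cons v l ih =>
    have hplay : ∀ i, ∃ c ∈ st i, ((v = i ∨ G.Adj v i) ∧ c = suitCard G f v i) ∨
        (¬ (v = i ∨ G.Adj v i) ∧ m ≤ c.2 ∧ c.2 ≠ ts) := by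
      intro i
      by_cases hvi : v = i ∨ G.Adj v i
      · exact ⟨_, hmem v (by simp) i hvi, .inl ⟨hvi, rfl⟩⟩
      · have h := hjunk i
        rw [List.countP_cons_of_pos (by simpa using hvi)] at h
        obtain ⟨c, hc⟩ := Finset.card_pos.1 (by omega :
          0 < ((st i).filter (fun c => m ≤ c.2 ∧ c.2 ≠ ts)).card)
        rw [Finset.mem_filter] at hc
        exact ⟨c, hc.1, .inr ⟨hvi, hc.2⟩⟩
    choose play hplay_mem hplay using hplay
    have hvm := v.isLt
    have hplay_suit : ∀ i, (play i).2 = v → (v = i ∨ G.Adj v i) ∧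
        play i = suitCard G f v i := by
      intro i hi
      rcases hplay i with h | h
      · exact h
      · omega
    have hplay_of : ∀ i, (v = i ∨ G.Adj v i) → play i = suitCard G f v i := fun i hi =>
      (hplay i).elim (·.2) (fun h => absurd hi h.1)
    have hplay_v : play v = (G.degree v + 1, (v : ℕ)) := by
      rw [hplay_of v (.inl rfl), suitCard_self]
    have hplay_lead : (play lead).2 = v := by
      rw [hplay_of lead (hlead v (by simp)), suitCard_snd]
    have hok : TrickOk st lead play := by
      refine ⟨fun i => ⟨_, hplay_mem i⟩, hplay_mem, fun i => ?_⟩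
      rw [hplay_lead]
      rcases hplay i with h | h
      · left; rw [h.2, suitCard_snd]
      · exact .inr fun c hc hcv => h.1 (hsuit i c hc v hcv)
    have hno_trump : ¬ ∃ j, (play j).2 = ts := by
      rintro ⟨j, hj⟩
      rcases hplay j with h | h
      · rw [h.2, suitCard_snd] at hj
        omega
      · exact h.2.2 hj
    have hwins : TrumpWins ts lead play v := by
      refine ⟨fun h => absurd h hno_trump, fun _ => ⟨by rw [hplay_lead, hplay_v], ?_⟩⟩
      intro j hj hjs
      obtain ⟨hadj, hc⟩ := hplay_suit j (hjs.trans hplay_lead)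
      have := hf_le v j (hadj.resolve_left (Ne.symm hj))
      rw [hc, hplay_v, suitCard, if_neg (Ne.symm hj)]
      exact Nat.lt_succ_of_le this
    obtain ⟨hvl, hnd'⟩ := List.nodup_cons.1 hnd
    obtain ⟨L, fin, hL, hLc⟩ := ih hnd' hchain.tail (nextState st play) v
      (fun u hu => .inr ((List.isChain_cons.1 hchain).1 u hu).symm)
      (fun u hu i hui => by
        refine Finset.mem_erase.2 ⟨fun he => ?_, hmem u (by simp [hu]) i hui⟩
        have hs : (play i).2 = u := by rw [← he, suitCard_snd]
        have hum := u.isLt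
        rcases hplay i with h | h
        · rw [h.2, suitCard_snd] at hs
          exact hvl (Fin.ext hs ▸ hu)
        · omega)
      (fun i c hc => hsuit i c (Finset.mem_of_mem_erase hc))
      (fun i => by
        have h := hjunk i
        rw [nextState, Finset.filter_erase]
        rcases hplay i with hi | hi
        · rw [Finset.erase_eq_of_notMem, ← List.countP_cons_of_neg (a := v) (by simpa [or_iff_not_imp_left] using hi.1)]
          · exact h
          · simp [hi.2, hvm]
        · rw [List.countP_cons_of_pos (by simpa using hi.1)] at h
          rw [Finset.card_erase_of_mem (Finset.mem_filter.2 ⟨hplay_mem i, hi.2⟩)]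
          omega)
    refine ⟨_, fin, .cons hok hwins hL, fun u hu => ?_⟩
    rcases List.mem_cons.1 hu with rfl | hu
    · exact ⟨_, List.mem_cons_self, ⟨u, hplay_v⟩, rfl⟩
    · obtain ⟨t, ht, htc⟩ := hLc u hu
      exact ⟨t, List.mem_cons_of_mem _ ht, htc⟩

theorem countP_not_adj_le {l : List (Fin m)} (hl : l.Nodup) (i : Fin m) :
    l.countP (fun v => ¬ (v = i ∨ G.Adj v i)) ≤ m - G.degree i - 1 := by
  rw [List.countP_eq_length_filter, ← List.toFinset_card_of_nodup (hl.filter _)]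
  calc _ ≤ (insert i (G.neighborFinset i))ᶜ.card := by
        refine Finset.card_le_card fun v hv => ?_
        simpa [G.adj_comm i v] using (List.mem_filter.1 (List.mem_toFinset.1 hv)).2
    _ = m - G.degree i - 1 := by
        rw [Finset.card_compl, Finset.card_insert_of_notMem (by simp), Fintype.card_fin,
          SimpleGraph.card_neighborFinset_eq_degree, Nat.sub_sub]

end Reduction

/-- A nonempty nodup chain of adjacent vertices covering the graph is the support of a
Hamiltonian path. -/
theorem SimpleGraph.exists_isHamiltonian_of_isChain {V : Type*} [DecidableEq V]
    {G : SimpleGraph V} {l : List V} (hne : l ≠ []) (hchain : l.IsChain G.Adj) (hnd : l.Nodup)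
    (hall : ∀ v, v ∈ l) : ∃ (a b : V) (w : G.Walk a b), w.IsHamiltonian :=
  ⟨_, _, .ofSupport l hne hchain, fun v => by
    rw [SimpleGraph.Walk.support_ofSupport]
    exact List.count_eq_one_of_mem hnd (hall v)⟩

/-- G has a Hamiltonian path iff the trump-variant instance I'(G),
obtained from I(G) by designating a fresh trump suit `ts` and dealing every
player except one fixed player `z` an arbitrary positive number of pairwise
distinct trump cards, admits a successful play sequence under the trump rules. -/
theorem hamiltonianPath_iff_crew_trump_success {m : ℕ} (hm : 2 ≤ m)
    (G : SimpleGraph (Fin m)) [DecidableRel G.Adj]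
    (f : Fin m → Fin m → ℕ)
    (hf_inj : ∀ i : Fin m, Set.InjOn (f i) (G.neighborFinset i))
    (hf_img : ∀ i : Fin m, (G.neighborFinset i).image (f i) = Finset.Icc 1 (G.degree i))
    (junk : Fin m → Finset Card)
    (hjcard : ∀ i, (junk i).card = m - G.degree i - 1)
    (hjsuit : ∀ i : Fin m, ∀ c ∈ junk i, m ≤ c.2)
    (hjdist : ∀ (i i' : Fin m) (c c' : Card), c ∈ junk i → c' ∈ junk i' →
      c.2 = c'.2 → i = i' ∧ c = c')
    (ts : ℕ) (hts_main : m ≤ ts)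
    (hts_junk : ∀ i : Fin m, ∀ c ∈ junk i, c.2 ≠ ts)
    (z : Fin m) (trumps : Fin m → Finset Card)
    (htr_suit : ∀ i : Fin m, ∀ c ∈ trumps i, c.2 = ts)
    (htr_z : trumps z = ∅)
    (htr_pos : ∀ i : Fin m, i ≠ z → (trumps i).Nonempty)
    (htr_disj : ∀ i i' : Fin m, i ≠ i' → Disjoint (trumps i) (trumps i')) :
    (∃ (a b : Fin m) (w : G.Walk a b), w.IsHamiltonian) ↔
      TrumpHasSuccess ts (fun j => reductionHand G f junk j ∪ trumps j)
        (reductionObjs G) := by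
  constructor
  · rintro ⟨a, b, w, hw⟩
    have hnd : w.support.Nodup := hw.isPath.support_nodup
    obtain ⟨L, fin, hL, hLc⟩ := exists_trumpPlaysFrom_of_isChain (ts := ts) hts_main
      (fun v i h => le_degree_of_adj hf_img h) w.support hnd w.isChain_adj_support
      (fun j => reductionHand G f junk j ∪ trumps j) a
      (fun v hv => .inl (by
        rw [← w.cons_tail_support, List.head?_cons, Option.mem_some_iff] at hv
        exact hv.symm))
      (fun v _ i hvi => Finset.mem_union_left _ (suitCard_mem_reductionHand hvi))
      (fun i c hc v hcv => (eq_suitCard_of_mem_hand hjsuit hts_main htr_suit hc hcv).1)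
      (fun i => by
        refine (countP_not_adj_le hnd i).trans ?_
        rw [← hjcard i]
        refine Finset.card_le_card fun c hc => Finset.mem_filter.2
          ⟨?_, hjsuit i c hc, hts_junk i c hc⟩
        exact Finset.mem_union_left _ (Finset.mem_union_right _ hc))
    refine ⟨a, L, fin, hL, fun o ho => ?_⟩
    obtain ⟨v, -, rfl⟩ := Finset.mem_image.1 ho
    exact hLc v (hw.mem_support v)
  · rintro ⟨lead, L, fin, hL, hsucc⟩
    have hobj : ∀ v : Fin m, ∃ t ∈ L, t.play v = (G.degree v + 1, (v : ℕ)) ∧ t.winner = v := by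
      intro v
      obtain ⟨t, ht, ⟨j, hj⟩, hwin⟩ := hsucc _ (Finset.mem_image_of_mem _ (Finset.mem_univ v))
      have hmem := hL.play_mem ht j
      rw [hj] at hmem
      obtain rfl := eq_of_objective_mem_hand hf_img hjsuit hts_main htr_suit hmem
      exact ⟨t, ht, hj, hwin⟩
    have hall : ∀ v, v ∈ L.map Trick.winner := fun v =>
      let ⟨t, ht, _, hwin⟩ := hobj v
      List.mem_map.2 ⟨t, ht, hwin⟩
    have hlen : (L.map Trick.winner).length ≤ m := by
      have h := hL.length_le_card z
      rw [htr_z, Finset.union_empty] at h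
      simpa using h.trans (card_reductionHand_le hjcard z)
    have huniv : (L.map Trick.winner).toFinset = Finset.univ :=
      Finset.eq_univ_of_forall fun v => List.mem_toFinset.2 (hall v)
    have hnd : (L.map Trick.winner).Nodup := by
      refine List.dedup_eq_self.1 ((List.dedup_sublist _).eq_of_length_le (hlen.trans ?_))
      rw [← List.card_toFinset, huniv, Finset.card_univ, Fintype.card_fin]
    have hplay : ∀ t ∈ L, t.play t.winner = (G.degree t.winner + 1, (t.winner : ℕ)) := by
      intro t ht
      obtain ⟨t', ht', hp, hwin⟩ := hobj t.winner
      obtain rfl := List.inj_on_of_nodup_map hnd ht' ht hwin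
      exact hp
    refine SimpleGraph.exists_isHamiltonian_of_isChain (List.ne_nil_of_mem (hall z)) ?_ hnd hall
    rw [List.isChain_map, List.isChain_iff_getElem]
    intro k hk
    have hlead := List.isChain_iff_getElem.1 hL.isChain k hk
    have ht : L[k + 1] ∈ L := List.getElem_mem hk
    have hp := hplay _ ht
    have hwlt := (L[k + 1].winner).isLt
    have hs := (hL.trumpWins ht).lead_suit (by rw [hp]; dsimp only; omega)
    rw [hp, hlead] at hs
    refine ((eq_suitCard_of_mem_hand hjsuit hts_main htr_suit
      (hL.play_mem ht L[k].winner) hs).1.resolve_left fun he => ?_).symm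
    have := List.inj_on_of_nodup_map hnd ht (List.getElem_mem (by omega)) he
    have hndL : L.Nodup := hnd.of_map _
    have := (hndL.getElem_inj_iff).1 this
    omega
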